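/- Let H be a finite-dimensional quasi-Hopf algebra over a field k with bijective antipode S (inverse S̄) and μ : H → k an algebra map. Suppose λ ∈ H* and Λ ∈ H satisfy: hΛ = ε(h)Λ for all h ∈ H; λ(xy) = λ(y·S(S(x) ↼ μ)) for all x, y ∈ H (where h ↼ μ = μ(h_(1))h_(2)); and q^R_1 Λ_(1) p^R_1 · ⟨λ, q^R_2 Λ_(2) p^R_2⟩ = 1. Set Λ̃ = q^R_1 Λ_(1) p^R_1 ⊗ q^R_2 Λ_(2) p^R_2 ∈ H⊗H. Then the linear maps Θ_L, Θ_R : H → H* given by Θ_L(h)(x) = λ(xh) and Θ_R(h)(x) = λ(hx) are bijective, with inverses Θ_L^{-1}(ξ) = S(Λ̃_1 ↼ μ)·⟨ξ, Λ̃_2⟩ and Θ_R^{-1}(ξ) = S̄(Λ̃_1)·⟨ξ, Λ̃_2⟩ for ξ ∈ H*. -/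

import Mathlib

open scoped TensorProduct

noncomputable section

/-- A quasi-Hopf algebra over a field `k`, presented together with explicit
(Sweedler-style) finite representations of the comultiplication and of the
associator `φ` and its inverse `φ⁻¹`.  The fields `n, d1, d2` give, for every
`h : H`, a finite family with `Δ h = ∑ i < n h, d1 h i ⊗ d2 h i`; similarly
`P1, P2, P3` (resp. `Q1, Q2, Q3`) are the components of `φ` (resp. `φ⁻¹`). -/
structure QuasiHopf (k H : Type) [Field k] [Ring H] [Algebra k H] where
  comul : H →ₐ[k] H ⊗[k] H
  counit : H →ₐ[k] k
  n : H → ℕ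
  d1 : H → ℕ → H
  d2 : H → ℕ → H
  comul_eq : ∀ h, comul h = ∑ i ∈ Finset.range (n h), d1 h i ⊗ₜ[k] d2 h i
  np : ℕ
  P1 : ℕ → H
  P2 : ℕ → H
  P3 : ℕ → H
  nq : ℕ
  Q1 : ℕ → H
  Q2 : ℕ → H
  Q3 : ℕ → H
  S : H →ₗ[k] H
  Sinv : H →ₗ[k] H
  alpha : H
  beta : H
  S_one : S 1 = 1
  S_mul : ∀ x y : H, S (x * y) = S y * S x
  Sinv_S : ∀ x : H, Sinv (S x) = x
  S_Sinv : ∀ x : H, S (Sinv x) = x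
  phi_phiInv :
    (∑ a ∈ Finset.range np, P1 a ⊗ₜ[k] (P2 a ⊗ₜ[k] P3 a)) *
      (∑ b ∈ Finset.range nq, Q1 b ⊗ₜ[k] (Q2 b ⊗ₜ[k] Q3 b)) = 1
  phiInv_phi :
    (∑ b ∈ Finset.range nq, Q1 b ⊗ₜ[k] (Q2 b ⊗ₜ[k] Q3 b)) *
      (∑ a ∈ Finset.range np, P1 a ⊗ₜ[k] (P2 a ⊗ₜ[k] P3 a)) = 1
  qcoassoc : ∀ h : H,
    ∑ i ∈ Finset.range (n h), d1 h i ⊗ₜ[k] comul (d2 h i) =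
      (∑ a ∈ Finset.range np, P1 a ⊗ₜ[k] (P2 a ⊗ₜ[k] P3 a)) *
        (∑ i ∈ Finset.range (n h), ∑ j ∈ Finset.range (n (d1 h i)),
          d1 (d1 h i) j ⊗ₜ[k] (d2 (d1 h i) j ⊗ₜ[k] d2 h i)) *
        (∑ b ∈ Finset.range nq, Q1 b ⊗ₜ[k] (Q2 b ⊗ₜ[k] Q3 b))
  counit_left : ∀ h : H, ∑ i ∈ Finset.range (n h), counit (d1 h i) • d2 h i = h
  counit_right : ∀ h : H, ∑ i ∈ Finset.range (n h), counit (d2 h i) • d1 h i = h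
  pentagon :
    (∑ a ∈ Finset.range np, P1 a ⊗ₜ[k] (P2 a ⊗ₜ[k] comul (P3 a))) *
      (∑ a ∈ Finset.range np, ∑ i ∈ Finset.range (n (P1 a)),
        d1 (P1 a) i ⊗ₜ[k] (d2 (P1 a) i ⊗ₜ[k] (P2 a ⊗ₜ[k] P3 a))) =
    ((1 : H) ⊗ₜ[k] (∑ a ∈ Finset.range np, P1 a ⊗ₜ[k] (P2 a ⊗ₜ[k] P3 a))) *
      (∑ a ∈ Finset.range np, ∑ i ∈ Finset.range (n (P2 a)),
        P1 a ⊗ₜ[k] (d1 (P2 a) i ⊗ₜ[k] (d2 (P2 a) i ⊗ₜ[k] P3 a))) *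
      (∑ a ∈ Finset.range np, P1 a ⊗ₜ[k] (P2 a ⊗ₜ[k] (P3 a ⊗ₜ[k] (1 : H))))
  counit_mid_phi :
    ∑ a ∈ Finset.range np, counit (P2 a) • (P1 a ⊗ₜ[k] P3 a) = (1 : H) ⊗ₜ[k] (1 : H)
  antipode_alpha : ∀ h : H,
    ∑ i ∈ Finset.range (n h), S (d1 h i) * alpha * d2 h i = counit h • alpha
  antipode_beta : ∀ h : H,
    ∑ i ∈ Finset.range (n h), d1 h i * beta * S (d2 h i) = counit h • beta
  nondeg_1 : ∑ a ∈ Finset.range np, P1 a * beta * S (P2 a) * alpha * P3 a = 1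
  nondeg_2 : ∑ b ∈ Finset.range nq, S (Q1 b) * alpha * Q2 b * beta * S (Q3 b) = 1
  counit_alpha : counit alpha = 1
  counit_beta : counit beta = 1

namespace QuasiHopf

variable {k H : Type} [Field k] [Ring H] [Algebra k H] (q : QuasiHopf k H)

/-- The associator `φ` as an element of `H ⊗ H ⊗ H`. -/
def Phi : H ⊗[k] (H ⊗[k] H) :=
  ∑ a ∈ Finset.range q.np, q.P1 a ⊗ₜ[k] (q.P2 a ⊗ₜ[k] q.P3 a)

/-- `φ⁻¹` as an element of `H ⊗ H ⊗ H`. -/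
def PhiInv : H ⊗[k] (H ⊗[k] H) :=
  ∑ b ∈ Finset.range q.nq, q.Q1 b ⊗ₜ[k] (q.Q2 b ⊗ₜ[k] q.Q3 b)

/-- first components of `p^R = φ̄1 ⊗ φ̄2 β S(φ̄3)` -/
def pR1 (b : ℕ) : H := q.Q1 b

def pR2 (b : ℕ) : H := q.Q2 b * q.beta * q.S (q.Q3 b)

def pRE : H ⊗[k] H := ∑ b ∈ Finset.range q.nq, q.pR1 b ⊗ₜ[k] q.pR2 b

/-- components of `q^R = φ1 ⊗ S̄(α φ3) φ2` -/
def qR1 (a : ℕ) : H := q.P1 a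

def qR2 (a : ℕ) : H := q.Sinv (q.alpha * q.P3 a) * q.P2 a

def qRE : H ⊗[k] H := ∑ a ∈ Finset.range q.np, q.qR1 a ⊗ₜ[k] q.qR2 a

/-- components of `p^L = φ2 S̄(φ1 β) ⊗ φ3` -/
def pL1 (a : ℕ) : H := q.P2 a * q.Sinv (q.P1 a * q.beta)

def pL2 (a : ℕ) : H := q.P3 a

def pLE : H ⊗[k] H := ∑ a ∈ Finset.range q.np, q.pL1 a ⊗ₜ[k] q.pL2 a

/-- components of `q^L = S(φ̄1) α φ̄2 ⊗ φ̄3` -/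
def qL1 (b : ℕ) : H := q.S (q.Q1 b) * q.alpha * q.Q2 b

def qL2 (b : ℕ) : H := q.Q3 b

def qLE : H ⊗[k] H := ∑ b ∈ Finset.range q.nq, q.qL1 b ⊗ₜ[k] q.qL2 b

/-- `𝕒 = S(φ̄1 φ2) α φ̄2 φ3₍₁₎ ⊗ S(φ1) α φ̄3 φ3₍₂₎` -/
def aEl : H ⊗[k] H :=
  ∑ a ∈ Finset.range q.np, ∑ b ∈ Finset.range q.nq, ∑ m ∈ Finset.range (q.n (q.P3 a)),
    (q.S (q.Q1 b * q.P2 a) * q.alpha * q.Q2 b * q.d1 (q.P3 a) m) ⊗ₜ[k]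
      (q.S (q.P1 a) * q.alpha * q.Q3 b * q.d2 (q.P3 a) m)

/-- `𝕓 = φ1₍₁₎ φ̄1 β S(φ3) ⊗ φ1₍₂₎ φ̄2 β S(φ2 φ̄3)` -/
def bEl : H ⊗[k] H :=
  ∑ a ∈ Finset.range q.np, ∑ b ∈ Finset.range q.nq, ∑ m ∈ Finset.range (q.n (q.P1 a)),
    (q.d1 (q.P1 a) m * q.Q1 b * q.beta * q.S (q.P3 a)) ⊗ₜ[k]
      (q.d2 (q.P1 a) m * q.Q2 b * q.beta * q.S (q.P2 a * q.Q3 b))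

/-- `(S ⊗ S)(Δ^cop x) = S(x₍₂₎) ⊗ S(x₍₁₎)` -/
def scop (x : H) : H ⊗[k] H :=
  ∑ m ∈ Finset.range (q.n x), q.S (q.d2 x m) ⊗ₜ[k] q.S (q.d1 x m)

/-- The Drinfeld twist `f = (S⊗S)(Δ^cop(p^R_1)) · 𝕒 · Δ(p^R_2)`. -/
def twist : H ⊗[k] H :=
  ∑ b ∈ Finset.range q.nq, q.scop (q.pR1 b) * q.aEl * q.comul (q.pR2 b)

/-- `f⁻¹ = Δ(q^L_1) · 𝕓 · (S⊗S)(Δ^cop(q^L_2))`. -/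
def twistInv : H ⊗[k] H :=
  ∑ b ∈ Finset.range q.nq, q.comul (q.qL1 b) * q.bEl * q.scop (q.qL2 b)

/-- `x ⊗ y ↦ S y ⊗ S x` -/
def sswap : H ⊗[k] H →ₗ[k] H ⊗[k] H :=
  (TensorProduct.map q.S q.S).comp (TensorProduct.comm k H H).toLinearMap

/-- `x ⊗ y ↦ S̄ y ⊗ S̄ x` -/
def sswapInv : H ⊗[k] H →ₗ[k] H ⊗[k] H :=
  (TensorProduct.map q.Sinv q.Sinv).comp (TensorProduct.comm k H H).toLinearMap

/-- `U^L = f̄1 S(q^R_2) ⊗ f̄2 S(q^R_1)` -/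
def UL : H ⊗[k] H := q.twistInv * q.sswap q.qRE

/-- `V^L = S̄(f2 p^R_2) ⊗ S̄(f1 p^R_1)` -/
def VL : H ⊗[k] H := q.sswapInv (q.twist * q.pRE)

/-- `U^R = S̄(q^L_2 f̄2) ⊗ S̄(q^L_1 f̄1)` -/
def UR : H ⊗[k] H := q.sswapInv (q.qLE * q.twistInv)

/-- `V^R = S(p^L_2) f1 ⊗ S(p^L_1) f2` -/
def VR : H ⊗[k] H := q.sswap q.pLE * q.twist

/-- `h ↦ h ↼ μ = μ(h₍₁₎) h₍₂₎` -/
def lhook (mu : H →ₐ[k] k) : H →ₗ[k] H :=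
  (TensorProduct.lid k H).toLinearMap.comp
    ((TensorProduct.map mu.toLinearMap LinearMap.id).comp q.comul.toLinearMap)

/-- `h ↦ μ ⇀ h = μ(h₍₂₎) h₍₁₎` -/
def rhook (mu : H →ₐ[k] k) : H →ₗ[k] H :=
  (TensorProduct.rid k H).toLinearMap.comp
    ((TensorProduct.map LinearMap.id mu.toLinearMap).comp q.comul.toLinearMap)

/-- `W^L = μ(φ̄1) f̄1 S(q^R_2 φ̄3) ⊗ f̄2 S((q^R_1 ↼ μ) φ̄2)` -/
def WL (mu : H →ₐ[k] k) : H ⊗[k] H :=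
  q.twistInv * q.sswap ((TensorProduct.map (q.lhook mu) LinearMap.id q.qRE) *
    (∑ b ∈ Finset.range q.nq, mu (q.Q1 b) • (q.Q2 b ⊗ₜ[k] q.Q3 b)))

/-- `W^R = μ(φ3) S̄((μ ⇀ q^L_2) φ2 f̄2) ⊗ S̄(q^L_1 φ1 f̄1)` -/
def WR (mu : H →ₐ[k] k) : H ⊗[k] H :=
  q.sswapInv ((TensorProduct.map LinearMap.id (q.rhook mu) q.qLE) *
    (∑ a ∈ Finset.range q.np, mu (q.P3 a) • (q.P1 a ⊗ₜ[k] q.P2 a)) * q.twistInv)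

section Modules

variable {V W X : Type} [AddCommGroup V] [Module k V] [AddCommGroup W] [Module k W]
  [AddCommGroup X] [Module k X]

/-- The tensor-product action `h · (v ⊗ w) = h₍₁₎ v ⊗ h₍₂₎ w`. -/
def tensAct (ρV : H → Module.End k V) (ρW : H → Module.End k W) (h : H) :
    Module.End k (V ⊗[k] W) :=
  ∑ i ∈ Finset.range (q.n h), TensorProduct.map (ρV (q.d1 h i)) (ρW (q.d2 h i))

/-- The action on the left dual: `(h · ξ)(x) = ξ(S(h) x)`. -/
def dualAct (ρX : H → Module.End k X) (h : H) : Module.End k (Module.Dual k X) :=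
  LinearMap.dualMap (ρX (q.S h))

end Modules

end QuasiHopf

/-- `f` intertwines the two given `H`-actions. -/
def IsHLin {k H V W : Type} [Field k] [Ring H] [Algebra k H]
    [AddCommGroup V] [Module k V] [AddCommGroup W] [Module k W]
    (ρV : H → Module.End k V) (ρW : H → Module.End k W) (f : V →ₗ[k] W) : Prop :=
  ∀ (h : H) (v : V), f (ρV h v) = ρW h (f v)

/-- `x ⊗ y ↦ λ(y) • x` -/
def hitR {k H : Type} [Field k] [Ring H] [Algebra k H] (lam : H →ₗ[k] k) :
    H ⊗[k] H →ₗ[k] H :=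
  (TensorProduct.rid k H).toLinearMap.comp (TensorProduct.map LinearMap.id lam)

/-- `x ⊗ y ↦ λ(x) • y` -/
def hitL {k H : Type} [Field k] [Ring H] [Algebra k H] (lam : H →ₗ[k] k) :
    H ⊗[k] H →ₗ[k] H :=
  (TensorProduct.lid k H).toLinearMap.comp (TensorProduct.map lam LinearMap.id)

namespace QuasiHopf

variable {k H : Type} [Field k] [Ring H] [Algebra k H] (q : QuasiHopf k H)

lemma Sinv_mul (x y : H) : q.Sinv (x * y) = q.Sinv y * q.Sinv x := by
  have h := q.Sinv_S (q.Sinv y * q.Sinv x)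
  rwa [q.S_mul, q.S_Sinv, q.S_Sinv] at h

/-- `a ⊗ b ⊗ c ↦ a ⊗ S̄(α c) b`, the map sending `φ` to `q^R`. -/
def contractAlpha : H ⊗[k] (H ⊗[k] H) →ₗ[k] H ⊗[k] H :=
  LinearMap.lTensor H (TensorProduct.lift
    (((LinearMap.mul k H).flip).compl₂ (q.Sinv ∘ₗ LinearMap.mulLeft k q.alpha)))

@[simp]
lemma contractAlpha_tmul (a b c : H) :
    q.contractAlpha (a ⊗ₜ[k] (b ⊗ₜ[k] c)) = a ⊗ₜ[k] (q.Sinv (q.alpha * c) * b) := by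
  simp [contractAlpha]

lemma contractAlpha_Phi_mul (x y z : H) :
    q.contractAlpha (q.Phi * (x ⊗ₜ[k] (y ⊗ₜ[k] z))) =
      ((1 : H) ⊗ₜ[k] q.Sinv z) * q.qRE * (x ⊗ₜ[k] y) := by
  simp only [Phi, qRE, qR1, qR2, Finset.sum_mul, Finset.mul_sum, map_sum,
    Algebra.TensorProduct.tmul_mul_tmul, contractAlpha_tmul, one_mul, ← mul_assoc]
  simp only [Sinv_mul, mul_assoc]

lemma sum_Sinv_alpha_mul (h : H) :
    ∑ i ∈ Finset.range (q.n h), q.Sinv (q.alpha * q.d2 h i) * q.d1 h i =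
      q.counit h • q.Sinv q.alpha := by
  rw [← map_smul, ← q.antipode_alpha h, map_sum]
  simp only [mul_assoc, Sinv_mul, Sinv_S]

lemma contractAlpha_mul_Phi (x y : H) :
    q.contractAlpha ((x ⊗ₜ[k] q.comul y) * q.Phi) =
      q.counit y • ((x ⊗ₜ[k] (1 : H)) * q.qRE) := by
  simp only [Phi, qRE, qR1, qR2, Finset.mul_sum, map_sum, Finset.smul_sum]
  refine Finset.sum_congr rfl fun a _ => ?_
  have key : ∑ i ∈ Finset.range (q.n y),
      q.Sinv (q.alpha * (q.d2 y i * q.P3 a)) * (q.d1 y i * q.P2 a) =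
        q.counit y • (q.Sinv (q.alpha * q.P3 a) * q.P2 a) := by
    rw [q.Sinv_mul q.alpha (q.P3 a), ← smul_mul_assoc, ← mul_smul_comm, ← sum_Sinv_alpha_mul,
      Finset.mul_sum, Finset.sum_mul]
    simp only [Sinv_mul, mul_assoc]
  simp only [q.comul_eq y, Algebra.TensorProduct.tmul_mul_tmul, Finset.sum_mul,
    TensorProduct.tmul_sum, map_sum, contractAlpha_tmul, one_mul]
  rw [← TensorProduct.tmul_sum, key, TensorProduct.tmul_smul]

lemma sum_tmul_comul_mul_Phi (h : H) :
    (∑ i ∈ Finset.range (q.n h), q.d1 h i ⊗ₜ[k] q.comul (q.d2 h i)) * q.Phi =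
      q.Phi * ∑ i ∈ Finset.range (q.n h), ∑ j ∈ Finset.range (q.n (q.d1 h i)),
        q.d1 (q.d1 h i) j ⊗ₜ[k] (q.d2 (q.d1 h i) j ⊗ₜ[k] q.d2 h i) := by
  rw [q.qcoassoc h, mul_assoc, Phi, q.phiInv_phi, mul_one]

/-- `q^R_1 h₍₁₁₎ ⊗ S̄(h₍₂₎) q^R_2 h₍₁₂₎ = h q^R_1 ⊗ q^R_2`. -/
lemma sum_Sinv_mul_qRE_mul_comul (h : H) :
    ∑ i ∈ Finset.range (q.n h),
        ((1 : H) ⊗ₜ[k] q.Sinv (q.d2 h i)) * q.qRE * q.comul (q.d1 h i) =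
      (h ⊗ₜ[k] (1 : H)) * q.qRE := by
  have hc := congrArg q.contractAlpha (q.sum_tmul_comul_mul_Phi h)
  simp only [Finset.sum_mul, Finset.mul_sum, map_sum, contractAlpha_Phi_mul,
    contractAlpha_mul_Phi] at hc
  simp only [← Finset.mul_sum, ← q.comul_eq] at hc
  rw [← hc]
  conv_rhs => rw [← q.counit_right h]
  simp only [TensorProduct.sum_tmul, Finset.sum_mul, ← TensorProduct.smul_tmul', smul_mul_assoc]

/-- `h Λ̃_1 ⊗ Λ̃_2 = Λ̃_1 ⊗ S̄(h) Λ̃_2` for a left integral `Λ`. -/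
lemma tmul_one_mul_qRE_mul_comul {Lam : H} (hint : ∀ h : H, h * Lam = q.counit h • Lam)
    (h : H) :
    (h ⊗ₜ[k] (1 : H)) * (q.qRE * q.comul Lam * q.pRE) =
      ((1 : H) ⊗ₜ[k] q.Sinv h) * (q.qRE * q.comul Lam * q.pRE) := by
  have hL : (h ⊗ₜ[k] (1 : H)) * q.qRE * q.comul Lam =
      ((1 : H) ⊗ₜ[k] q.Sinv h) * q.qRE * q.comul Lam := by
    rw [← sum_Sinv_mul_qRE_mul_comul, Finset.sum_mul]
    conv_rhs => rw [← q.counit_left h]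
    simp only [mul_assoc _ (q.comul _) (q.comul _), ← map_mul, hint, map_smul, map_sum,
      TensorProduct.tmul_sum, Finset.sum_mul, TensorProduct.tmul_smul, smul_mul_assoc,
      mul_smul_comm]
  simp only [← mul_assoc, hL]

end QuasiHopf

/-- Frobenius property of a left cointegral: with
`Λ̃ = q^R_1 Λ₍₁₎ p^R_1 ⊗ q^R_2 Λ₍₂₎ p^R_2`, the maps `Θ_L(h) = λ(·h)` and
`Θ_R(h) = λ(h·)` are bijections `H → H*`, with inverses
`Θ_L⁻¹(ξ) = S(Λ̃1 ↼ μ) ⟨ξ, Λ̃2⟩` and `Θ_R⁻¹(ξ) = S̄(Λ̃1) ⟨ξ, Λ̃2⟩`. -/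
theorem statement12 (k H : Type) [Field k] [Ring H] [Algebra k H]
    [FiniteDimensional k H] (q : QuasiHopf k H)
    (mu : H →ₐ[k] k) (lam : H →ₗ[k] k) (Lam : H)
    (hint : ∀ h : H, h * Lam = q.counit h • Lam)
    (hnak : ∀ x y : H, lam (x * y) = lam (y * q.S (q.lhook mu (q.S x))))
    (hnorm : hitR lam (q.qRE * q.comul Lam * q.pRE) = 1) :
    Function.Bijective (fun h : H => lam ∘ₗ LinearMap.mulRight k h) ∧
    Function.Bijective (fun h : H => lam ∘ₗ LinearMap.mulLeft k h) ∧
    (∀ xi : H →ₗ[k] k,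
      (lam ∘ₗ LinearMap.mulRight k
        (((TensorProduct.rid k H).toLinearMap ∘ₗ
            TensorProduct.map (q.S ∘ₗ q.lhook mu) xi)
          (q.qRE * q.comul Lam * q.pRE))) = xi) ∧
    (∀ h : H,
      ((TensorProduct.rid k H).toLinearMap ∘ₗ
          TensorProduct.map (q.S ∘ₗ q.lhook mu) (lam ∘ₗ LinearMap.mulRight k h))
        (q.qRE * q.comul Lam * q.pRE) = h) ∧
    (∀ xi : H →ₗ[k] k,
      (lam ∘ₗ LinearMap.mulLeft k
        (((TensorProduct.rid k H).toLinearMap ∘ₗ TensorProduct.map q.Sinv xi)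
          (q.qRE * q.comul Lam * q.pRE))) = xi) ∧
    (∀ h : H,
      ((TensorProduct.rid k H).toLinearMap ∘ₗ
          TensorProduct.map q.Sinv (lam ∘ₗ LinearMap.mulLeft k h))
        (q.qRE * q.comul Lam * q.pRE) = h) := by
  set T := q.qRE * q.comul Lam * q.pRE with hT
  set G : (H →ₗ[k] k) → H := fun xi =>
    ((TensorProduct.rid k H).toLinearMap ∘ₗ TensorProduct.map q.Sinv xi) T with hG
  set N : H → H := fun x => q.S (q.lhook mu (q.S x)) with hN
  let R : H →ₗ[k] (H →ₗ[k] k) := (LinearMap.mul k H).compr₂ lam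
  have hR (h : H) : R h = lam ∘ₗ LinearMap.mulLeft k h := LinearMap.ext fun _ => rfl
  have hRN (x : H) : lam ∘ₗ LinearMap.mulRight k (N x) = R x :=
    LinearMap.ext fun y => (hnak x y).symm
  have hGR (h : H) : G (R h) = h := by
    have hmap : ∀ t : H ⊗[k] H,
        ((TensorProduct.rid k H).toLinearMap ∘ₗ TensorProduct.map q.Sinv (R h)) t =
          q.Sinv (hitR lam (((1 : H) ⊗ₜ[k] h) * t)) := fun t => by
      induction t with
      | zero => simp
      | tmul x y => simp [hitR, hR]
      | add x y hx hy => rw [map_add, hx, hy, mul_add, map_add, map_add]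
    have hleft : ∀ t : H ⊗[k] H,
        hitR lam ((q.S h ⊗ₜ[k] (1 : H)) * t) = q.S h * hitR lam t := fun t => by
      induction t with
      | zero => simp
      | tmul x y => simp [hitR]
      | add x y hx hy => rw [mul_add, map_add, hx, hy, map_add, mul_add]
    have hswap := q.tmul_one_mul_qRE_mul_comul hint (q.S h)
    rw [q.Sinv_S, ← hT] at hswap
    simp only [hG]
    rw [hmap, ← hswap, hleft, hnorm, mul_one, q.Sinv_S]
  have hRbij : Function.Bijective R := by
    have hinj : Function.Injective R := Function.LeftInverse.injective hGR
    exact ⟨hinj, (LinearMap.injective_iff_surjective_of_finrank_eq_finrank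
      (Subspace.dual_finrank_eq (K := k) (V := H)).symm).1 hinj⟩
  have hRG (xi : H →ₗ[k] k) : R (G xi) = xi := by
    obtain ⟨h, rfl⟩ := hRbij.2 xi
    rw [hGR]
  have hNG (xi : H →ₗ[k] k) :
      ((TensorProduct.rid k H).toLinearMap ∘ₗ TensorProduct.map (q.S ∘ₗ q.lhook mu) xi) T =
        N (G xi) := by
    simp only [hG, hN]
    induction T with
    | zero => simp
    | tmul x y => simp [q.S_Sinv]
    | add x y hx hy => simp only [map_add, hx, hy]
  have hNsurj : Function.Surjective N := by
    let N' : H →ₗ[k] H := q.S ∘ₗ q.lhook mu ∘ₗ q.S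
    have hinj : Function.Injective N' := fun x y hxy => hRbij.1 <| by
      rw [← hRN, ← hRN, show N x = N y from hxy]
    exact LinearMap.injective_iff_surjective.1 hinj
  have hLinv (h : H) : N (G (lam ∘ₗ LinearMap.mulRight k h)) = h := by
    obtain ⟨x, rfl⟩ := hNsurj h
    rw [hRN, hGR]
  have hinvL (xi : H →ₗ[k] k) : lam ∘ₗ LinearMap.mulRight k (N (G xi)) = xi := by
    rw [hRN, hRG]
  refine ⟨Function.bijective_iff_has_inverse.2 ⟨fun xi => N (G xi), hLinv, hinvL⟩, ?_,
    fun xi => ?_, fun h => ?_, fun xi => ?_, fun h => ?_⟩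
  · simpa only [← hR] using hRbij
  · rw [hNG, hinvL]
  · rw [hNG, hLinv]
  · exact (hR _).symm.trans (hRG xi)
  · rw [← hR]; exact hGR h
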